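/- arXiv:2207.09277 — 2 statements merged into one kernel-verified Lean document; each statement's English description precedes it below -/
import Mathlib

section
/- There exist constants c_1, c_2 > 0 and an integer N such that for all n ≥ N, c_1 · 2^n ≤ B_2(n,2,3;3) ≤ c_2 · 2^n; i.e., B_2(n,2,3;3) = Θ(2^n). -/
open Module

/-- The Gaussian binomial coefficient `[n choose m]_q`, as a rational number:
`∏_{i=0}^{m-1} (q^n - q^i)/(q^m - q^i)`. -/
def gaussBinom (q n m : ℕ) : ℚ :=
  ∏ i ∈ Finset.range m, ((q : ℚ) ^ n - (q : ℚ) ^ i) / ((q : ℚ) ^ m - (q : ℚ) ^ i)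

/-- `C` is an `α`-`(n, k, δ)_q^c` covering Grassmannian code over `F` (where `|F| = q`):
a set of `k`-dimensional subspaces of `F^n` such that any `α` distinct members
span a subspace of dimension at least `k + δ`. -/
def IsCoveringCode (F : Type) [Field F] (n k δ α : ℕ)
    (C : Finset (Submodule F (Fin n → F))) : Prop :=
  (∀ U ∈ C, finrank F ↥U = k) ∧
  ∀ S : Finset (Submodule F (Fin n → F)), S ⊆ C → S.card = α →
    k + δ ≤ finrank F ↥(S.sup id)

/-- The number of codewords of `C` containing the subspace `W`. -/
noncomputable def containCount {F : Type} [Field F] {n : ℕ}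
    (C : Finset (Submodule F (Fin n → F))) (W : Submodule F (Fin n → F)) : ℕ :=
  Nat.card {U : Submodule F (Fin n → F) // U ∈ C ∧ W ≤ U}

/-- `B_q(n, k, δ; α)`: the maximum cardinality of an `α`-`(n, k, δ)_q^c`
covering Grassmannian code over `F`. -/
noncomputable def maxCodeCard (F : Type) [Field F] (n k δ α : ℕ) : ℕ :=
  sSup {m : ℕ | ∃ C : Finset (Submodule F (Fin n → F)),
    IsCoveringCode F n k δ α C ∧ C.card = m}


/-- Codewords of a `3`-`(n, 2, 3)` covering code through a fixed nonzero vector: at most two. -/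
theorem IsCoveringCode.card_le_two_of_mem {F : Type} [Field F] {n : ℕ}
    {C D : Finset (Submodule F (Fin n → F))} (hC : IsCoveringCode F n 2 3 3 C)
    {v : Fin n → F} (hv : v ≠ 0) (hDC : D ⊆ C) (hD : ∀ U ∈ D, v ∈ U) : D.card ≤ 2 := by
  classical
  by_contra! h
  obtain ⟨S, hSD, hS⟩ := Finset.exists_subset_card_eq (Nat.succ_le_of_lt h)
  have hspan := hC.2 S (hSD.trans hDC) hS
  obtain ⟨X, Y, Z, -, -, -, rfl⟩ := Finset.card_eq_three.1 hS
  have hX := hC.1 X (hDC (hSD (by simp)))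
  have hY := hC.1 Y (hDC (hSD (by simp)))
  have hZ := hC.1 Z (hDC (hSD (by simp)))
  have hvX := hD X (hSD (by simp))
  have hvY := hD Y (hSD (by simp))
  have hvZ := hD Z (hSD (by simp))
  have one_le : ∀ W : Submodule F (Fin n → F), v ∈ W → 1 ≤ finrank F W := fun W hW =>
    Submodule.one_le_finrank_iff.2 ((Submodule.ne_bot_iff W).2 ⟨v, hW, hv⟩)
  have h₁ := Submodule.finrank_sup_add_finrank_inf_eq Y Z
  have h₂ := Submodule.finrank_sup_add_finrank_inf_eq X (Y ⊔ Z)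
  have h₃ := one_le (Y ⊓ Z) ⟨hvY, hvZ⟩
  have h₄ := one_le (X ⊓ (Y ⊔ Z)) ⟨hvX, Submodule.mem_sup_left hvY⟩
  rw [Finset.sup_insert, Finset.sup_insert, Finset.sup_singleton] at hspan
  simp only [id_eq] at hspan
  omega

theorem IsCoveringCode.card_le {F : Type} [Field F] [Fintype F] {n : ℕ}
    {C : Finset (Submodule F (Fin n → F))} (hC : IsCoveringCode F n 2 3 3 C) :
    C.card ≤ 2 * Fintype.card F ^ n := by
  classical
  have hex : ∀ U : Submodule F (Fin n → F), ∃ v, U ∈ C → v ∈ U ∧ v ≠ 0 := by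
    intro U
    by_cases hU : U ∈ C
    · have hne : U ≠ ⊥ := Submodule.one_le_finrank_iff.1 (by rw [hC.1 U hU]; norm_num)
      obtain ⟨v, hv, hv0⟩ := (Submodule.ne_bot_iff U).1 hne
      exact ⟨v, fun _ => ⟨hv, hv0⟩⟩
    · exact ⟨0, fun h => absurd h hU⟩
  choose f hf using hex
  have hcard : C.card ≤ 2 * (Finset.univ : Finset (Fin n → F)).card := by
    refine Finset.card_le_mul_card_image_of_maps_to (f := f) (fun _ _ => Finset.mem_univ _) 2 ?_
    intro v _
    by_cases hv : v = 0
    · subst hv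
      rw [Finset.filter_false_of_mem (s := C) fun U hU => (hf U hU).2]
      simp
    · refine hC.card_le_two_of_mem hv (Finset.filter_subset _ _) fun U hU => ?_
      obtain ⟨hUC, rfl⟩ := Finset.mem_filter.1 hU
      exact (hf U hUC).1
  simpa using hcard

section Construction

variable {K : Type*} [Field K] [Algebra (ZMod 2) K]

/-- If `g ^ 4 ≠ g`, no two-dimensional `𝔽₂`-subspace of `K` is stable under multiplication
by `g`. -/
theorem three_le_finrank_of_mul_mem [Finite K] {g a b : K} (hg : g ^ 4 ≠ g) (ha : a ≠ 0)
    (hb : b ≠ 0) (hab : a ≠ b) {W : Submodule (ZMod 2) K} (haW : a ∈ W) (hbW : b ∈ W)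
    (hgaW : g * a ∈ W) (hgbW : g * b ∈ W) : 3 ≤ finrank (ZMod 2) W := by
  classical
  have : CharP K 2 := charP_of_injective_algebraMap (algebraMap (ZMod 2) K).injective 2
  have h2 : (2 : K) = 0 := CharTwo.two_eq_zero
  by_contra! hW
  have : Fintype K := Fintype.ofFinite K
  have hcardW : Fintype.card W ≤ 4 := by
    rw [Module.card_eq_pow_finrank (K := ZMod 2) (V := W), ZMod.card]
    exact (Nat.pow_le_pow_right two_pos (Nat.le_of_lt_succ hW)).trans_eq (by norm_num)
  have hne : a + b ≠ 0 := fun h => hab (CharTwo.add_eq_zero.1 h)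
  have hcard : ({0, a, b, a + b} : Finset K).card = 4 := by
    rw [Finset.card_insert_of_notMem, Finset.card_insert_of_notMem, Finset.card_pair] <;>
      simp [ha, hb, hab, ha.symm, hb.symm, hne.symm]
  have hsub : ({0, a, b, a + b} : Finset K) ⊆ Finset.univ.filter (· ∈ W) := by
    intro v hv
    simp only [Finset.mem_insert, Finset.mem_singleton] at hv
    simp only [Finset.mem_filter, Finset.mem_univ, true_and]
    rcases hv with rfl | rfl | rfl | rfl
    exacts [W.zero_mem, haW, hbW, W.add_mem haW hbW]
  have heq := Finset.eq_of_subset_of_card_le hsub (by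
    rw [hcard, ← Fintype.card_subtype]; exact hcardW)
  have mem : ∀ v ∈ W, v = 0 ∨ v = a ∨ v = b ∨ v = a + b := fun v hv => by
    have : v ∈ ({0, a, b, a + b} : Finset K) := by rw [heq]; simpa using hv
    simpa using this
  have hg0 : g ≠ 0 := by rintro rfl; simp at hg
  have hg1 : g ≠ 1 := by rintro rfl; simp at hg
  have hg2 : g ^ 2 + g + 1 ≠ 0 := fun h => hg (by linear_combination (g ^ 2 - g) * h)
  have hg3 : g + 1 ≠ 0 := fun h => hg1 (CharTwo.add_eq_zero.1 h)
  -- `g * a` is neither `0` nor `a`, so `b` is `g * a` or `(g + 1) * a`.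
  rcases mem _ hgaW with h | h | h | h
  · exact mul_ne_zero hg0 ha h
  · exact hg1 (mul_right_cancel₀ ha (by rw [h, one_mul]))
  · subst h
    rcases mem _ hgbW with h | h | h | h
    · simp [hg0, ha] at h
    · have : (g + 1) * (g + 1) * a = 0 := by linear_combination h + (g + 1) * a * h2
      simp [hg3, ha] at this
    · exact hg1 (mul_right_cancel₀ hb (by rw [h, one_mul]))
    · have : (g ^ 2 + g + 1) * a = 0 := by linear_combination h + (g + 1) * a * h2
      simp [hg2, ha] at this
  · obtain rfl : b = (g + 1) * a := by linear_combination -h - a * h2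
    rcases mem _ hgbW with h | h | h | h
    · simp [hg0, ha, hg3] at h
    · have : (g ^ 2 + g + 1) * a = 0 := by linear_combination h + a * h2
      simp [hg2, ha] at this
    · exact hg1 (mul_right_cancel₀ hb (by rw [h, one_mul]))
    · have : g ^ 2 * a = 0 := by linear_combination h + a * h2
      simp [hg0, ha] at this

/-- The map `(s, t) ↦ (s, t, s x + t g x)`. -/
def liftMap (g x : K) : (ZMod 2 × ZMod 2) →ₗ[ZMod 2] (ZMod 2 × ZMod 2) × K :=
  LinearMap.id.prod
    ((LinearMap.toSpanSingleton (ZMod 2) K x).coprod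
      (LinearMap.toSpanSingleton (ZMod 2) K (g * x)))

theorem liftMap_apply (g x : K) (p : ZMod 2 × ZMod 2) :
    liftMap g x p = (p, p.1 • x + p.2 • (g * x)) := rfl

theorem liftMap_injective (g x : K) : Function.Injective (liftMap g x) :=
  fun _ _ h => congrArg Prod.fst h

theorem finrank_range_liftMap (g x : K) :
    finrank (ZMod 2) (LinearMap.range (liftMap g x)) = 2 := by
  rw [LinearMap.finrank_range_of_inj (liftMap_injective g x)]
  simp

theorem range_liftMap_injective (g : K) :
    Function.Injective fun x : K => LinearMap.range (liftMap g x) := by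
  intro x y h
  obtain ⟨p, hp⟩ : liftMap g x (1, 0) ∈ LinearMap.range (liftMap g y) := by
    rw [← show LinearMap.range (liftMap g x) = LinearMap.range (liftMap g y) from h]
    exact LinearMap.mem_range_self _ _
  simp only [liftMap_apply, Prod.mk.injEq] at hp
  obtain ⟨rfl, hp⟩ := hp
  simpa using hp.symm

theorem five_le_finrank_sup_range_liftMap [Finite K] {g x y z : K} (hg : g ^ 4 ≠ g)
    (hxy : x ≠ y) (hxz : x ≠ z) (hyz : y ≠ z) :
    5 ≤ finrank (ZMod 2) ↥(LinearMap.range (liftMap g x) ⊔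
      (LinearMap.range (liftMap g y) ⊔ LinearMap.range (liftMap g z))) := by
  set S := LinearMap.range (liftMap g x) ⊔
      (LinearMap.range (liftMap g y) ⊔ LinearMap.range (liftMap g z))
  have hx : ∀ p, liftMap g x p ∈ S := fun p =>
    Submodule.mem_sup_left (LinearMap.mem_range_self _ p)
  have hy : ∀ p, liftMap g y p ∈ S := fun p =>
    Submodule.mem_sup_right (Submodule.mem_sup_left (LinearMap.mem_range_self _ p))
  have hz : ∀ p, liftMap g z p ∈ S := fun p =>
    Submodule.mem_sup_right (Submodule.mem_sup_right (LinearMap.mem_range_self _ p))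
  let W : Submodule (ZMod 2) K := S.comap (LinearMap.inr (ZMod 2) (ZMod 2 × ZMod 2) K)
  have hW : 3 ≤ finrank (ZMod 2) W := by
    refine three_le_finrank_of_mul_mem (a := x - y) (b := x - z) hg (sub_ne_zero.2 hxy)
      (sub_ne_zero.2 hxz) (fun h => hyz (sub_right_injective h)) ?_ ?_ ?_ ?_
    · simpa [W, liftMap_apply] using S.sub_mem (hx (1, 0)) (hy (1, 0))
    · simpa [W, liftMap_apply] using S.sub_mem (hx (1, 0)) (hz (1, 0))
    · simpa [W, liftMap_apply, mul_sub] using S.sub_mem (hx (0, 1)) (hy (0, 1))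
    · simpa [W, liftMap_apply, mul_sub] using S.sub_mem (hx (0, 1)) (hz (0, 1))
  let φ : ((ZMod 2 × ZMod 2) × W) →ₗ[ZMod 2] (ZMod 2 × ZMod 2) × K :=
    (liftMap g x).coprod ((LinearMap.inr (ZMod 2) (ZMod 2 × ZMod 2) K).comp W.subtype)
  have hφS : ∀ p, φ p ∈ S := fun p => S.add_mem (hx p.1) p.2.2
  have hφ : Function.Injective φ := by
    rw [← LinearMap.ker_eq_bot, LinearMap.ker_eq_bot']
    rintro ⟨p, w⟩ h
    simp only [φ, LinearMap.coprod_apply, liftMap_apply, LinearMap.comp_apply,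
      Submodule.subtype_apply, LinearMap.inr_apply, Prod.mk_add_mk, add_zero,
      Prod.mk_eq_zero] at h
    obtain ⟨rfl, h⟩ := h
    simpa using h
  have hle := LinearMap.finrank_le_finrank_of_injective (f := φ.codRestrict S hφS)
    (fun p q h => hφ (congrArg Subtype.val h))
  simp only [Module.finrank_prod, Module.finrank_self] at hle
  omega

end Construction

/-- The lifted code `{(s, t, s x + t g x)}`, `x ∈ 𝔽_{2^m}`, has `2 ^ m` codewords. -/
theorem exists_isCoveringCode_card_eq {m : ℕ} (hm : 3 ≤ m) :
    ∃ C : Finset (Submodule (ZMod 2) (Fin (m + 2) → ZMod 2)),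
      IsCoveringCode (ZMod 2) (m + 2) 2 3 3 C ∧ C.card = 2 ^ m := by
  classical
  let K := GaloisField 2 m
  have : Fintype K := Fintype.ofFinite K
  have hK : Fintype.card K = 2 ^ m := by
    rw [← Nat.card_eq_fintype_card]; exact GaloisField.card 2 m (by omega)
  obtain ⟨g, hg⟩ : ∃ g : K, g ^ 4 ≠ g := by
    by_contra! h
    have hle := Polynomial.card_le_degree_of_subset_roots
      (p := (Polynomial.X ^ 4 - Polynomial.X : Polynomial K)) (Z := Finset.univ) (by
        intro v _
        rw [Polynomial.mem_roots (FiniteField.X_pow_card_sub_X_ne_zero K (by norm_num))]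
        simp [h v])
    rw [FiniteField.X_pow_card_sub_X_natDegree_eq K (by norm_num), Finset.card_univ, hK] at hle
    have : 2 ^ 3 ≤ 2 ^ m := Nat.pow_le_pow_right two_pos hm
    omega
  have hfin : finrank (ZMod 2) ((ZMod 2 × ZMod 2) × K) =
      finrank (ZMod 2) (Fin (m + 2) → ZMod 2) := by
    simp only [Module.finrank_prod, Module.finrank_self, Module.finrank_fin_fun]
    rw [GaloisField.finrank 2 (by omega)]
    omega
  let e := LinearEquiv.ofFinrankEq _ _ hfin
  let U : K → Submodule (ZMod 2) (Fin (m + 2) → ZMod 2) := fun x =>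
    (LinearMap.range (liftMap g x)).map (e : _ →ₗ[ZMod 2] _)
  have hU : Function.Injective U :=
    (Submodule.map_injective_of_injective e.injective).comp (range_liftMap_injective g)
  refine ⟨Finset.univ.image U, ⟨?_, ?_⟩, ?_⟩
  · intro V hV
    obtain ⟨x, -, rfl⟩ := Finset.mem_image.1 hV
    exact (LinearEquiv.finrank_map_eq e _).trans (finrank_range_liftMap g x)
  · intro S hS hcard
    obtain ⟨X, Y, Z, hXY, hXZ, hYZ, rfl⟩ := Finset.card_eq_three.1 hcard
    obtain ⟨x, -, rfl⟩ := Finset.mem_image.1 (hS (show X ∈ _ by simp))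
    obtain ⟨y, -, rfl⟩ := Finset.mem_image.1 (hS (show Y ∈ _ by simp))
    obtain ⟨z, -, rfl⟩ := Finset.mem_image.1 (hS (show Z ∈ _ by simp))
    have hsup : ({U x, U y, U z} : Finset _).sup id = (LinearMap.range (liftMap g x) ⊔
        (LinearMap.range (liftMap g y) ⊔ LinearMap.range (liftMap g z))).map
          (e : _ →ₗ[ZMod 2] _) := by
      simp [U, Submodule.map_sup]
    rw [hsup]
    refine (five_le_finrank_sup_range_liftMap hg (ne_of_apply_ne U hXY)
      (ne_of_apply_ne U hXZ) (ne_of_apply_ne U hYZ)).trans_eq ?_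
    exact (LinearEquiv.finrank_map_eq e _).symm
  · rw [Finset.card_image_of_injective _ hU, Finset.card_univ, hK]

/-- `B_2(n,2,3;3) = Θ(2^n)`: there are constants
`c₁, c₂ > 0` and `N` such that `c₁·2^n ≤ B_2(n,2,3;3) ≤ c₂·2^n` for all `n ≥ N`. -/
theorem stmt_10 :
    ∃ c₁ c₂ : ℝ, 0 < c₁ ∧ 0 < c₂ ∧ ∃ N : ℕ, ∀ n : ℕ, N ≤ n →
      c₁ * 2 ^ n ≤ (maxCodeCard (ZMod 2) n 2 3 3 : ℝ) ∧
      (maxCodeCard (ZMod 2) n 2 3 3 : ℝ) ≤ c₂ * 2 ^ n := by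
  refine ⟨1 / 4, 2, by norm_num, by norm_num, 5, fun n hn => ?_⟩
  obtain ⟨m, rfl⟩ : ∃ m, n = m + 2 := ⟨n - 2, by omega⟩
  have hmem := exists_isCoveringCode_card_eq (m := m) (by omega)
  have hub : ∀ k ∈ {k : ℕ | ∃ C : Finset (Submodule (ZMod 2) (Fin (m + 2) → ZMod 2)),
      IsCoveringCode (ZMod 2) (m + 2) 2 3 3 C ∧ C.card = k}, k ≤ 2 * 2 ^ (m + 2) := by
    rintro _ ⟨C, hC, rfl⟩
    simpa using hC.card_le
  have hlower : 2 ^ m ≤ maxCodeCard (ZMod 2) (m + 2) 2 3 3 := le_csSup ⟨_, hub⟩ hmem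
  have hupper : maxCodeCard (ZMod 2) (m + 2) 2 3 3 ≤ 2 * 2 ^ (m + 2) := csSup_le ⟨_, hmem⟩ hub
  constructor
  · have : (2 : ℝ) ^ m ≤ maxCodeCard (ZMod 2) (m + 2) 2 3 3 := by exact_mod_cast hlower
    rw [pow_add]
    linarith
  · exact_mod_cast hupper
end

section
/- Let n, k and γ be positive integers with k ≥ 3⌈γ/2⌉ and n ≥ 2k + γ. Then B_2(n,k,k+γ;3) ≥ 2^{⌊(n−2k+1)/(k+1)⌋·⌊k/⌈γ/2⌉⌋}; that is, there exists a 3-(n,k,k+γ)_2^c covering Grassmannian code of cardinality 2^{⌊(n−2k+1)/(k+1)⌋·⌊k/⌈γ/2⌉⌋}. -/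
open Module

open Polynomial

/-- The additive map `u ↦ u + u² X`, whose image in `L[X]` is a Sidon space. -/
noncomputable def sidonMap (L : Type*) [Field L] [CharP L 2] [Module (ZMod 2) L] :
    L →ₗ[ZMod 2] L[X] :=
  AddMonoidHom.toZModLinearMap 2
    { toFun := fun u => C u + C (u ^ 2) * X
      map_zero' := by simp
      map_add' := fun u v => by rw [CharTwo.add_sq]; simp only [C_add]; ring }

section SidonMap

variable {L : Type*} [Field L] [CharP L 2] [Module (ZMod 2) L]

theorem sidonMap_apply (u : L) : sidonMap L u = C u + C (u ^ 2) * X := rfl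

theorem coeff_zero_sidonMap (u : L) : (sidonMap L u).coeff 0 = u := by
  simp [sidonMap_apply]

theorem coeff_one_sidonMap (u : L) : (sidonMap L u).coeff 1 = u ^ 2 := by
  rw [sidonMap_apply, coeff_add, coeff_C_succ, coeff_C_mul, coeff_X_one, mul_one, zero_add]

theorem sidonMap_injective : Function.Injective (sidonMap L) := fun u v h => by
  rw [← coeff_zero_sidonMap u, h, coeff_zero_sidonMap]

theorem sidonMap_ne_zero {u : L} (hu : u ≠ 0) : sidonMap L u ≠ 0 :=
  (map_ne_zero_iff _ sidonMap_injective).2 hu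

theorem natDegree_sidonMap_le (u : L) : (sidonMap L u).natDegree ≤ 1 := by
  rw [sidonMap_apply, add_comm]
  exact natDegree_linear_le

/-- The Sidon property of the image of `sidonMap`. -/
theorem eq_or_eq_of_sidonMap_mul_eq {u v u' v' : L} (hu : u ≠ 0) (hv' : v' ≠ 0)
    (h : sidonMap L u * sidonMap L v' = sidonMap L v * sidonMap L u') :
    u = v ∨ u = u' := by
  have h0 := congrArg (fun p => p.coeff 0) h
  have h1 := congrArg (fun p => p.coeff 1) h
  simp only [mul_coeff_zero, mul_coeff_one, coeff_zero_sidonMap, coeff_one_sidonMap] at h0 h1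
  have hs : u + v' = v + u' := by
    refine mul_left_cancel₀ (mul_ne_zero hu hv') ?_
    linear_combination h1 - (v + u') * h0
  have : (u - v) * (u - u') = 0 := by
    linear_combination u * hs - h0
  simpa [sub_eq_zero] using this

/-- Two nonzero elements of the relation space between `α` and `β` coincide. -/
theorem sidonMap_relation_unique {α β : L[X]} (hα : α ≠ 0) (hβ : β ≠ 0) (hαβ : α + β ≠ 0)
    {u v u' v' : L} (h : α * sidonMap L u + β * sidonMap L v = 0)
    (h' : α * sidonMap L u' + β * sidonMap L v' = 0) (hne : u ≠ 0 ∨ v ≠ 0)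
    (hne' : u' ≠ 0 ∨ v' ≠ 0) : u = u' ∧ v = v' := by
  have key : ∀ {x y : L}, α * sidonMap L x + β * sidonMap L y = 0 → (x = 0 ↔ y = 0) := by
    intro x y hxy
    constructor
    · rintro rfl
      by_contra hy
      exact mul_ne_zero hβ (sidonMap_ne_zero hy) (by simpa using hxy)
    · rintro rfl
      by_contra hx
      exact mul_ne_zero hα (sidonMap_ne_zero hx) (by simpa using hxy)
  have k1 := key h
  have k2 := key h'
  have hu : u ≠ 0 := by tauto
  have hv' : v' ≠ 0 := by tauto
  have hmul : sidonMap L u * sidonMap L v' = sidonMap L v * sidonMap L u' := by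
    refine mul_left_cancel₀ (mul_ne_zero hα hβ) ?_
    linear_combination β * sidonMap L v' * h - β * sidonMap L v * h'
  rcases eq_or_eq_of_sidonMap_mul_eq hu hv' hmul with rfl | rfl
  · exact absurd (by linear_combination h) (mul_ne_zero hαβ (sidonMap_ne_zero hu))
  · refine ⟨rfl, sidonMap_injective (mul_left_cancel₀ hβ ?_)⟩
    linear_combination h - h'

end SidonMap

theorem eq_zero_of_mem_degreeLT {L : Type*} [Field L] {d : ℕ} {p : L[X]} (hp : p ∈ degreeLT L d)
    (h : ∀ i : Fin d, p.coeff i = 0) : p = 0 := by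
  ext i
  rcases lt_or_ge i d with hi | hi
  · exact h ⟨i, hi⟩
  · exact coeff_eq_zero_of_degree_lt ((mem_degreeLT.1 hp).trans_le (by exact_mod_cast hi))

section Codewords

variable {L : Type*} [Field L] [CharP L 2] [Algebra (ZMod 2) L]

/-- The map `u ↦ (u, a (u + u² X))`, with the polynomial recorded by its first `d` coefficients;
its range is the codeword attached to `a`. -/
noncomputable def codewordMap (d : ℕ) (a : L[X]) : L →ₗ[ZMod 2] L × (Fin d → L) :=
  LinearMap.prod LinearMap.id
    (LinearMap.pi fun i =>
      (lcoeff L i).restrictScalars (ZMod 2) ∘ₗ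
        LinearMap.mulLeft (ZMod 2) a ∘ₗ sidonMap L)

theorem codewordMap_snd (d : ℕ) (a : L[X]) (u : L) (i : Fin d) :
    (codewordMap d a u).2 i = (a * sidonMap L u).coeff i := rfl

theorem codewordMap_injective (d : ℕ) (a : L[X]) : Function.Injective (codewordMap d a) :=
  fun _ _ h => congrArg Prod.fst h

theorem mul_sidonMap_mem_degreeLT {t : ℕ} {a : L[X]} (ha : a ∈ degreeLT L t) (u : L) :
    a * sidonMap L u ∈ degreeLT L (t + 1) := by
  rw [mem_degreeLT] at ha ⊢
  rcases eq_or_ne a 0 with rfl | h0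
  · simp
  · refine degree_le_natDegree.trans_lt ?_
    rw [degree_eq_natDegree h0] at ha
    have h1 : a.natDegree < t := by exact_mod_cast ha
    have h2 := natDegree_mul_le (p := a) (q := sidonMap L u)
    have h3 := natDegree_sidonMap_le u
    exact_mod_cast (by omega : (a * sidonMap L u).natDegree < t + 1)

theorem codewordMap_range_injOn (t : ℕ) :
    Set.InjOn (fun a => LinearMap.range (codewordMap (t + 1) a)) (degreeLT L t : Set L[X]) := by
  intro a ha b hb (hab : LinearMap.range _ = LinearMap.range _)
  obtain ⟨w, hw⟩ : codewordMap (t + 1) a 1 ∈ LinearMap.range (codewordMap (t + 1) b) :=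
    hab ▸ LinearMap.mem_range_self _ _
  obtain rfl : w = 1 := congrArg Prod.fst hw
  have h : a * sidonMap L 1 - b * sidonMap L 1 = 0 := by
    refine eq_zero_of_mem_degreeLT (d := t + 1)
      (sub_mem (mul_sidonMap_mem_degreeLT ha 1) (mul_sidonMap_mem_degreeLT hb 1)) fun i => ?_
    rw [coeff_sub, ← codewordMap_snd, ← codewordMap_snd, hw, sub_self]
  exact mul_right_cancel₀ (sidonMap_ne_zero one_ne_zero) (sub_eq_zero.1 h)

/-- The codewords of three distinct polynomials are independent up to one dimension. -/
theorem finrank_sup_range_codewordMap [Module.Finite (ZMod 2) L] {t : ℕ} {a b c : L[X]}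
    (ha : a ∈ degreeLT L t) (hb : b ∈ degreeLT L t) (hc : c ∈ degreeLT L t)
    (hab : a ≠ b) (hac : a ≠ c) (hbc : b ≠ c) :
    3 * finrank (ZMod 2) L ≤ finrank (ZMod 2) ↥(LinearMap.range (codewordMap (t + 1) a) ⊔
      LinearMap.range (codewordMap (t + 1) b) ⊔ LinearMap.range (codewordMap (t + 1) c)) + 1 := by
  set Ψ := ((codewordMap (t + 1) a).coprod (codewordMap (t + 1) b)).coprod
    (codewordMap (t + 1) c) with hΨ
  have hrange : LinearMap.range Ψ = LinearMap.range (codewordMap (t + 1) a) ⊔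
      LinearMap.range (codewordMap (t + 1) b) ⊔ LinearMap.range (codewordMap (t + 1) c) := by
    rw [hΨ, LinearMap.range_coprod, LinearMap.range_coprod]
  have hker : ∀ w u v, ((w, u), v) ∈ LinearMap.ker Ψ →
      w = u + v ∧ (a - b) * sidonMap L u + (a - c) * sidonMap L v = 0 := by
    intro w u v hx
    have hx' : codewordMap (t + 1) a w + codewordMap (t + 1) b u
      + codewordMap (t + 1) c v = 0 := hx
    have h1 : w + u + v = 0 := congrArg Prod.fst hx'
    have hw : w = u + v := by
      rw [← CharTwo.neg_eq (u + v)]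
      linear_combination h1
    refine ⟨hw, ?_⟩
    have h2 : a * sidonMap L w + b * sidonMap L u + c * sidonMap L v = 0 := by
      refine eq_zero_of_mem_degreeLT (d := t + 1)
        (add_mem (add_mem (mul_sidonMap_mem_degreeLT ha _) (mul_sidonMap_mem_degreeLT hb _))
          (mul_sidonMap_mem_degreeLT hc _)) fun i => ?_
      simpa [codewordMap_snd] using congrFun (congrArg Prod.snd hx') i
    rw [hw, map_add] at h2
    rw [CharTwo.sub_eq_add, CharTwo.sub_eq_add]
    linear_combination h2
  have hker1 : finrank (ZMod 2) (LinearMap.ker Ψ) ≤ 1 := by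
    have huniq : ∀ x y : LinearMap.ker Ψ, x ≠ 0 → y ≠ 0 → x = y := by
      rintro ⟨⟨⟨w, u⟩, v⟩, hx⟩ ⟨⟨⟨w', u'⟩, v'⟩, hy⟩ hx0 hy0
      obtain ⟨rfl, h⟩ := hker _ _ _ hx
      obtain ⟨rfl, h'⟩ := hker _ _ _ hy
      have hne : u ≠ 0 ∨ v ≠ 0 := by
        by_contra! hc
        obtain ⟨rfl, rfl⟩ := hc
        exact hx0 (by ext <;> simp)
      have hne' : u' ≠ 0 ∨ v' ≠ 0 := by
        by_contra! hc
        obtain ⟨rfl, rfl⟩ := hc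
        exact hy0 (by ext <;> simp)
      have hsum : (a - b) + (a - c) ≠ 0 := by
        rw [CharTwo.sub_eq_add a b, CharTwo.sub_eq_add a c,
          show a + b + (a + c) = (a + a) + (b + c) by ring, CharTwo.add_self_eq_zero, zero_add,
          ← CharTwo.sub_eq_add]
        exact sub_ne_zero.2 hbc
      obtain ⟨rfl, rfl⟩ := sidonMap_relation_unique (sub_ne_zero.2 hab) (sub_ne_zero.2 hac)
        hsum h h' hne hne'
      rfl
    by_cases hz : ∀ x : LinearMap.ker Ψ, x = 0
    · exact finrank_le_one 0 fun w => ⟨0, by rw [hz w, smul_zero]⟩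
    · push Not at hz
      obtain ⟨x, hx⟩ := hz
      refine finrank_le_one x fun w => ?_
      by_cases hw : w = 0
      · exact ⟨0, by rw [hw, zero_smul]⟩
      · exact ⟨1, by rw [one_smul, huniq x w hx hw]⟩
  have hrn := LinearMap.finrank_range_add_finrank_ker Ψ
  rw [Module.finrank_prod, Module.finrank_prod, hrange] at hrn
  omega

end Codewords

/-- If `(t + 2) k ≤ n`, there are `2 ^ (t k)` subspaces of `F_2^n` of dimension `k`, any three of
which span a subspace of dimension at least `3 k - 1`. -/
theorem exists_isCoveringCode {n k t : ℕ} (hk : k ≠ 0) (hn : k + (t + 1) * k ≤ n) :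
    ∃ C : Finset (Submodule (ZMod 2) (Fin n → ZMod 2)),
      IsCoveringCode (ZMod 2) n k (2 * k - 1) 3 C ∧ C.card = 2 ^ (t * k) := by
  classical
  let L := GaloisField 2 k
  have hL : finrank (ZMod 2) L = k := GaloisField.finrank 2 hk
  obtain ⟨ι, hι⟩ : ∃ ι : L × (Fin (t + 1) → L) →ₗ[ZMod 2] (Fin n → ZMod 2),
      Function.Injective ι := by
    rw [← finrank_le_iff_exists_linearMap]
    simpa [Module.finrank_pi_fintype, hL] using hn
  have : Finite (degreeLT L t) := Finite.of_equiv _ (degreeLTEquiv L t).symm.toEquiv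
  have : Fintype (degreeLT L t) := Fintype.ofFinite _
  let U : degreeLT L t → Submodule (ZMod 2) (Fin n → ZMod 2) := fun a =>
    (LinearMap.range (codewordMap (t + 1) (a : L[X]))).map ι
  have hU : Function.Injective U := fun a b h =>
    Subtype.ext (codewordMap_range_injOn t a.2 b.2 (Submodule.map_injective_of_injective hι h))
  refine ⟨Finset.univ.image U, ⟨?_, ?_⟩, ?_⟩
  · simp only [Finset.mem_image, Finset.mem_univ, true_and, forall_exists_index,
      forall_apply_eq_imp_iff]
    intro a
    rw [← (Submodule.equivMapOfInjective ι hι _).finrank_eq,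
      LinearMap.finrank_range_of_inj (codewordMap_injective _ _), hL]
  · intro S hS hcard
    obtain ⟨x, y, z, hxy, hxz, hyz, rfl⟩ := Finset.card_eq_three.1 hcard
    have hmem : ∀ w ∈ ({x, y, z} : Finset _), ∃ a, U a = w := fun w hw => by
      simpa using hS hw
    obtain ⟨a, rfl⟩ := hmem x (by simp)
    obtain ⟨b, rfl⟩ := hmem y (by simp)
    obtain ⟨c, rfl⟩ := hmem z (by simp)
    have h := finrank_sup_range_codewordMap a.2 b.2 c.2
      (fun h => hxy (congrArg U (Subtype.ext h))) (fun h => hxz (congrArg U (Subtype.ext h)))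
      (fun h => hyz (congrArg U (Subtype.ext h)))
    have hsup : ({U a, U b, U c} : Finset _).sup id =
        (LinearMap.range (codewordMap (t + 1) (a : L[X])) ⊔
          LinearMap.range (codewordMap (t + 1) (b : L[X])) ⊔
          LinearMap.range (codewordMap (t + 1) (c : L[X]))).map ι := by
      simp [U, Submodule.map_sup, sup_assoc]
    rw [hsup, ← (Submodule.equivMapOfInjective ι hι _).finrank_eq]
    omega
  · rw [Finset.card_image_of_injective _ hU, Finset.card_univ, ← Nat.card_eq_fintype_card,
      Nat.card_congr (degreeLTEquiv L t).toEquiv, Nat.card_fun, GaloisField.card 2 k hk]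
    simp [← pow_mul, mul_comm]

theorem IsCoveringCode.mono {F : Type} [Field F] {n k δ δ' α : ℕ}
    {C C' : Finset (Submodule F (Fin n → F))} (h : IsCoveringCode F n k δ α C)
    (hδ : δ' ≤ δ) (hC : C' ⊆ C) : IsCoveringCode F n k δ' α C' :=
  ⟨fun U hU => h.1 U (hC hU), fun S hS hα =>
    (Nat.add_le_add_left hδ k).trans (h.2 S (hS.trans hC) hα)⟩

/-- For `k ≥ 3⌈γ/2⌉` and `n ≥ 2k + γ` there exists a
`3`-`(n,k,k+γ)_2^c` code of cardinality `2^{⌊(n−2k+1)/(k+1)⌋·⌊k/⌈γ/2⌉⌋}`. -/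
theorem stmt_11 (n k γ : ℕ) (hγ : 1 ≤ γ) (hk : 3 * ((γ + 1) / 2) ≤ k)
    (hn : 2 * k + γ ≤ n) :
    ∃ C : Finset (Submodule (ZMod 2) (Fin n → ZMod 2)),
      IsCoveringCode (ZMod 2) n k (k + γ) 3 C ∧
      C.card = 2 ^ (((n - 2 * k + 1) / (k + 1)) * (k / ((γ + 1) / 2))) := by
  have hk0 : k ≠ 0 := by omega
  set t := (n - 2 * k + 1) / (k + 1) with ht
  have hdiv : t * (k + 1) ≤ n - 2 * k + 1 := Nat.div_mul_le_self _ _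
  have hn' : k + (t + 1) * k ≤ n := by
    rcases Nat.eq_zero_or_pos t with h0 | h0
    · rw [h0]; omega
    · have : k + (t + 1) * k + t = 2 * k + t * (k + 1) := by ring
      omega
  obtain ⟨C, hC, hcard⟩ := exists_isCoveringCode hk0 hn'
  have hle : 2 ^ (t * (k / ((γ + 1) / 2))) ≤ C.card := by
    rw [hcard]
    exact Nat.pow_le_pow_right two_pos (Nat.mul_le_mul_left t (Nat.div_le_self _ _))
  obtain ⟨C', hC', hcard'⟩ := Finset.exists_subset_card_eq hle
  exact ⟨C', hC.mono (by omega) hC', hcard'⟩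
end
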